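/- For all commands c and stores σ, ρ such that ⊢{c}Γ, ⟨c,σ⟩ →* ⟨skip,σ'⟩ and ⟨c,ρ⟩ →* ⟨skip,ρ'⟩: if σ ≡_{Γ(x)} ρ for a program variable x, then σ'(x) = ρ'(x). -/

import Mathlib

/-- Program variables. -/
abbrev PVar := String
/-- Channels. -/
abbrev Chan := String
/-- Program points. -/
abbrev PPoint := String
/-- Values. -/
abbrev Val := ℤ
/-- Stores map program variables to values. -/
abbrev Store := PVar → Val

/-- Expressions: integer constants or variables. -/
inductive Expr where
  | const : Val → Expr
  | var : PVar → Expr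
deriving DecidableEq

def Expr.eval : Expr → Store → Val
  | .const v, _ => v
  | .var x, σ => σ x

def Expr.fv : Expr → Set PVar
  | .const _ => ∅
  | .var x => {x}

/-- Commands of the while-language with annotated outputs. -/
inductive Cmd where
  | skip : Cmd
  | seq : Cmd → Cmd → Cmd
  | assign : PVar → Expr → Cmd
  | ite : Expr → Cmd → Cmd → Cmd
  | while : Expr → Cmd → Cmd
  | out : Expr → Chan → PPoint → Cmd
deriving DecidableEq

/-- Step labels: silent, or an output (channel, value, program point). -/
inductive Label where
  | silent : Label
  | out : Chan → Val → PPoint → Label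
deriving DecidableEq

abbrev Config := Cmd × Store

/-- Small-step semantics. -/
inductive Step : Config → Label → Config → Prop where
  | skipSeq : ∀ (c : Cmd) (σ : Store), Step (.seq .skip c, σ) .silent (c, σ)
  | seq : ∀ {c₁ : Cmd} {σ : Store} {α : Label} {c₁' : Cmd} {σ' : Store} (c₂ : Cmd),
      Step (c₁, σ) α (c₁', σ') → Step (.seq c₁ c₂, σ) α (.seq c₁' c₂, σ')
  | assign : ∀ (x : PVar) (e : Expr) (σ : Store),
      Step (.assign x e, σ) .silent (.skip, Function.update σ x (e.eval σ))
  | out : ∀ (e : Expr) (a : Chan) (p : PPoint) (σ : Store),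
      Step (.out e a p, σ) (.out a (e.eval σ) p) (.skip, σ)
  | whileStep : ∀ (e : Expr) (c : Cmd) (σ : Store),
      Step (.while e c, σ) .silent (.ite e (.seq c (.while e c)) .skip, σ)
  | iteTrue : ∀ {e : Expr} {σ : Store} (c₁ c₂ : Cmd),
      e.eval σ ≠ 0 → Step (.ite e c₁ c₂, σ) .silent (c₁, σ)
  | iteFalse : ∀ {e : Expr} {σ : Store} (c₁ c₂ : Cmd),
      e.eval σ = 0 → Step (.ite e c₁ c₂, σ) .silent (c₂, σ)

/-- Prepend a label to a list of (output) labels, dropping silent labels. -/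
def Label.consTo : Label → List Label → List Label
  | .silent, ls => ls
  | l, ls => l :: ls

/-- `Steps cfg ls n cfg'`: `n` evaluation steps from `cfg` to `cfg'`, producing
the list `ls` of output labels (silent steps contribute nothing). -/
inductive Steps : Config → List Label → ℕ → Config → Prop where
  | refl : ∀ cfg, Steps cfg [] 0 cfg
  | step : ∀ {cfg : Config} {α : Label} {cfg' : Config} {ls : List Label} {n : ℕ} {cfg'' : Config},
      Step cfg α cfg' → Steps cfg' ls n cfg'' → Steps cfg (α.consTo ls) (n+1) cfg''

/-- Projection of a label list to the values output on channel `a`. -/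
def projA (a : Chan) (ls : List Label) : List Val :=
  ls.filterMap fun l => match l with
    | .silent => none
    | .out b v _ => if b = a then some v else none

/-- `⟨c,σ⟩ ⇒t_a,n ⟨c',σ'⟩`: n steps producing trace `t` of values on channel `a`. -/
def ProjSteps (cfg : Config) (a : Chan) (t : List Val) (n : ℕ) (cfg' : Config) : Prop :=
  ∃ ls, Steps cfg ls n cfg' ∧ projA a ls = t

/-- `⟨c,σ⟩ ⇒t_a`: the run of `c` from `σ` produces trace `t` on channel `a`. -/
def Produces (c : Cmd) (σ : Store) (a : Chan) (t : List Val) : Prop :=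
  ∃ n cfg', ProjSteps (c, σ) a t n cfg'

/-- A forgetful attacker: a deterministic automaton over values. -/
structure Attacker (S : Type) where
  init : S
  step : S → Val → S

/-- The attacker's state after observing trace `t`. -/
def Attacker.run {S : Type} (A : Attacker S) (t : List Val) : S :=
  t.foldl A.step A.init

/-- The counting variant `A^ω` of an attacker. -/
def Attacker.omega {S : Type} (A : Attacker S) : Attacker (S × ℕ) where
  init := (A.init, 0)
  step := fun sn v => (A.step sn.1 v, sn.2 + 1)

/-- Attacker knowledge `k(A,c,a,t)`. -/
def know {S : Type} (A : Attacker S) (c : Cmd) (a : Chan) (t : List Val) : Set Store :=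
  { ρ | ∃ t', Produces c ρ a t' ∧ A.run t' = A.run t }

/-- Exclusion knowledge `ek(A,c,a,t)`. -/
def ek {S : Type} (A : Attacker S) (c : Cmd) (a : Chan) (t : List Val) : Set Store :=
  (know A c a t)ᶜ

/-- Full progress knowledge `k#(A,c,a,t)`. -/
def kSharp {S : Type} (A : Attacker S) (c : Cmd) (a : Chan) (t : List Val) : Set Store :=
  { ρ | ∃ t' v, Produces c ρ a (t' ++ [v]) ∧ A.omega.run t' = A.omega.run t }

/-- Exclusion version `ek#(A,c,a,t)`. -/
def ekSharp {S : Type} (A : Attacker S) (c : Cmd) (a : Chan) (t : List Val) : Set Store :=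
  (kSharp A c a t)ᶜ

/-- AC progress knowledge `k⁺(A,c,a,t)`. -/
def kPlus {S : Type} (A : Attacker S) (c : Cmd) (a : Chan) (t : List Val) : Set Store :=
  { ρ | ∃ t' v, Produces c ρ a (t' ++ [v]) ∧ A.run t' = A.run t }

/-- Exclusion version `ek⁺(A,c,a,t)`. -/
def ekPlus {S : Type} (A : Attacker S) (c : Cmd) (a : Chan) (t : List Val) : Set Store :=
  (kPlus A c a t)ᶜ

/-- A dynamic policy: an equivalence relation on stores per channel and execution point. -/
structure DynPolicy where
  rel : Chan → Cmd → Store → ℕ → Store → Store → Prop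
  isEquiv : ∀ a c σ n, Equivalence (rel a c σ n)

/-- Progress-insensitive security of `c` for policy `D` against attacker `A`
on channel `a` for initial store `σ`. -/
def PISecure {S : Type} (c : Cmd) (D : DynPolicy) (A : Attacker S) (a : Chan) (σ : Store) : Prop :=
  ∀ t n c' σ' v, ProjSteps (c, σ) a t n (c', σ') →
    (∃ cfg', ProjSteps (c', σ') a [v] 1 cfg') →
    ek A c a (t ++ [v]) \ ekSharp A c a t ⊆ { ρ | ¬ D.rel a c σ n ρ σ }

/-- AC progress-insensitive security of `c` for policy `D` against attacker `A`
on channel `a` for initial store `σ`. -/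
def ACPISecure {S : Type} (c : Cmd) (D : DynPolicy) (A : Attacker S) (a : Chan) (σ : Store) : Prop :=
  ∀ t n c' σ' v, ProjSteps (c, σ) a t n (c', σ') →
    (∃ cfg', ProjSteps (c', σ') a [v] 1 cfg') →
    ek A c a (t ++ [v]) \ ekPlus A c a t ⊆ { ρ | ¬ D.rel a c σ n ρ σ }

/-- Two-run progress-insensitive security. -/
def TwoRunPISecure (c : Cmd) (D : DynPolicy) (a : Chan) (σ : Store) : Prop :=
  ∀ t n cn σn v, ProjSteps (c, σ) a t n (cn, σn) →
    (∃ cfg', ProjSteps (cn, σn) a [v] 1 cfg') →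
    ∀ ρ t' v', D.rel a c σ n ρ σ → Produces c ρ a (t' ++ [v']) → t'.length = t.length →
      v' = v

/-- A counting attacker always remembers at least how many outputs it has seen. -/
def Attacker.Counting {S : Type} (A : Attacker S) : Prop :=
  ∀ t t' : List Val, A.run t = A.run t' → t.length = t'.length

/-- A command is quasi-constant if, per channel, all its traces are prefixes of
one fixed (possibly infinite) trace. -/
def QuasiConstant (c : Cmd) : Prop :=
  ∀ a : Chan, ∃ u : ℕ → Val, ∀ σ t, Produces c σ a t →
    ∀ i : Fin t.length, t.get i = u i.val

/-- The variables of the dependency type system. -/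
inductive TVar where
  | pvar : PVar → TVar
  | cpoint : Chan → PPoint → TVar
  | pc : TVar
  | chan : Chan → TVar
deriving DecidableEq

/-- Type environments. -/
abbrev Env := TVar → Set TVar

/-- The identity environment. -/
def idEnv : Env := fun x => {x}

/-- Sequential composition of environments: `(Γ₂;Γ₁)(x) = ⋃_{y ∈ Γ₂(x)} Γ₁(y)`. -/
def envComp (Γ₂ Γ₁ : Env) : Env := fun x => ⋃ y ∈ Γ₂ x, Γ₁ y

/-- Pointwise union of environments. -/
def envUnion (Γ₁ Γ₂ : Env) : Env := fun x => Γ₁ x ∪ Γ₂ x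

/-- Iterates of an environment. -/
def envIter (Γ : Env) : ℕ → Env
  | 0 => idEnv
  | n+1 => envComp (envIter Γ n) Γ

/-- The fixed point `Γ* = ⋃_{n≥0} Γⁿ`. -/
def envStar (Γ : Env) : Env := fun x => ⋃ n, envIter Γ n x

/-- Free variables of an expression, as type-system variables. -/
def fvT (e : Expr) : Set TVar := TVar.pvar '' e.fv

/-- The dependency type system `⊢{c}Γ`. -/
inductive Typing : Cmd → Env → Prop where
  | skip : Typing .skip idEnv
  | assign : ∀ (x : PVar) (e : Expr),
      Typing (.assign x e) (Function.update idEnv (.pvar x) (fvT e ∪ {TVar.pc}))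
  | seq : ∀ {c₁ : Cmd} {Γ₁ : Env} {c₂ : Cmd} {Γ₂ : Env},
      Typing c₁ Γ₁ → Typing c₂ Γ₂ → Typing (.seq c₁ c₂) (envComp Γ₂ Γ₁)
  | ite : ∀ {e : Expr} {c₁ : Cmd} {Γ₁ : Env} {c₂ : Cmd} {Γ₂ : Env},
      Typing c₁ Γ₁ → Typing c₂ Γ₂ →
      Typing (.ite e c₁ c₂)
        (Function.update
          (envUnion (envComp Γ₁ (Function.update idEnv .pc ({TVar.pc} ∪ fvT e)))
                    (envComp Γ₂ (Function.update idEnv .pc ({TVar.pc} ∪ fvT e))))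
          .pc {TVar.pc})
  | whileT : ∀ {e : Expr} {c : Cmd} {Γc : Env}, Typing c Γc →
      Typing (.while e c)
        (Function.update
          (envStar (envComp Γc (Function.update idEnv .pc ({TVar.pc} ∪ fvT e))))
          .pc {TVar.pc})
  | out : ∀ (e : Expr) (a : Chan) (p : PPoint),
      Typing (.out e a p)
        (Function.update
          (Function.update idEnv (.cpoint a p)
            (fvT e ∪ {TVar.pc, TVar.chan a, TVar.cpoint a p}))
          (.chan a) {TVar.pc, TVar.chan a})

/-- `σ ≡_{Γ(x)} ρ`: the stores agree on all program variables in `Γ(x)`. -/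
def eqG (Γ : Env) (x : TVar) (σ ρ : Store) : Prop :=
  ∀ y : PVar, TVar.pvar y ∈ Γ x → σ y = ρ y

/-- A dynamic policy approximation: an equivalence relation on stores per
channel–program-point pair. -/
structure PolApprox where
  rel : Chan → PPoint → Store → Store → Prop
  isEquiv : ∀ a p, Equivalence (rel a p)

/-- `c : A` is a sound approximation of dynamic policy `D`. -/
def SoundApprox (c : Cmd) (A : PolApprox) (D : DynPolicy) : Prop :=
  ∀ σ n ls c' σ' a v p cfg'',
    Steps (c, σ) ls n (c', σ') → Step (c', σ') (.out a v p) cfg'' →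
    ∀ ρ₁ ρ₂, D.rel a c σ n ρ₁ ρ₂ → A.rel a p ρ₁ ρ₂

/-- Big-step semantics (stores only). -/
inductive BigStep : Cmd → Store → Store → Prop where
  | skip : ∀ (σ : Store), BigStep Cmd.skip σ σ
  | seq : ∀ {c₁ c₂ : Cmd} {σ τ υ : Store}, BigStep c₁ σ τ → BigStep c₂ τ υ → BigStep (Cmd.seq c₁ c₂) σ υ
  | assign : ∀ (x : PVar) (e : Expr) (σ : Store),
      BigStep (Cmd.assign x e) σ (Function.update σ x (e.eval σ))
  | out : ∀ (e : Expr) (a : Chan) (p : PPoint) (σ : Store), BigStep (Cmd.out e a p) σ σ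
  | iteTrue : ∀ {e : Expr} {c₁ c₂ : Cmd} {σ τ : Store},
      e.eval σ ≠ 0 → BigStep c₁ σ τ → BigStep (Cmd.ite e c₁ c₂) σ τ
  | iteFalse : ∀ {e : Expr} {c₁ c₂ : Cmd} {σ τ : Store},
      e.eval σ = 0 → BigStep c₂ σ τ → BigStep (Cmd.ite e c₁ c₂) σ τ
  | whileTrue : ∀ {e : Expr} {c : Cmd} {σ τ υ : Store},
      e.eval σ ≠ 0 → BigStep c σ τ → BigStep (Cmd.while e c) τ υ → BigStep (Cmd.while e c) σ υ
  | whileFalse : ∀ {e : Expr} {c : Cmd} {σ : Store}, e.eval σ = 0 → BigStep (Cmd.while e c) σ σ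

theorem big_of_step {cfg cfg' : Config} {α : Label} (h : Step cfg α cfg') :
    ∀ τ, BigStep cfg'.1 cfg'.2 τ → BigStep cfg.1 cfg.2 τ := by
  induction h with
  | skipSeq c σ => intro τ h; exact .seq (.skip _) h
  | seq c₂ _ ih =>
    intro τ h
    cases h with
    | seq h1 h2 => exact .seq (ih _ h1) h2
  | assign x e σ => intro τ h; cases h; exact .assign _ _ _
  | out e a p σ => intro τ h; cases h; exact .out _ _ _ _
  | whileStep e c σ =>
    intro τ h
    cases h with
    | iteTrue he h =>
      cases h with
      | seq h1 h2 => exact .whileTrue he h1 h2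
    | iteFalse he h => cases h; exact .whileFalse he
  | iteTrue c₁ c₂ he => intro τ h; exact .iteTrue he h
  | iteFalse c₁ c₂ he => intro τ h; exact .iteFalse he h

theorem big_of_steps {cfg cfg' : Config} {ls : List Label} {n : ℕ} (h : Steps cfg ls n cfg') :
    cfg'.1 = .skip → BigStep cfg.1 cfg.2 cfg'.2 := by
  induction h with
  | refl cfg => intro h; rw [h]; exact .skip _
  | step h _ ih => intro hs; exact big_of_step h _ (ih hs)

theorem typing_pc {c : Cmd} {Γ : Env} (h : Typing c Γ) : TVar.pc ∈ Γ .pc := by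
  induction h with
  | seq _ _ ih1 ih2 =>
    simp only [envComp, Set.mem_iUnion]
    exact ⟨_, ih2, ih1⟩
  | _ => simp [idEnv]

/-- The guard-extended environment. -/
abbrev guardEnv (Γ : Env) (e : Expr) : Env :=
  envComp Γ (Function.update idEnv .pc ({TVar.pc} ∪ fvT e))

theorem guard_of_mem {Γ : Env} {e : Expr} {x y : TVar} (h : y ∈ Γ x) : y ∈ guardEnv Γ e x := by
  simp only [guardEnv, envComp, Set.mem_iUnion]
  refine ⟨y, h, ?_⟩
  by_cases hy : y = .pc
  · subst hy; simp
  · simp [hy, idEnv]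

theorem guard_fv {Γ : Env} {e : Expr} {x y : TVar} (h : TVar.pc ∈ Γ x) (hy : y ∈ fvT e) :
    y ∈ guardEnv Γ e x := by
  simp only [guardEnv, envComp, Set.mem_iUnion]
  exact ⟨_, h, by simp [hy]⟩

theorem star_self (G : Env) (x : TVar) : x ∈ envStar G x :=
  Set.mem_iUnion.2 ⟨0, by simp [envIter, idEnv]⟩

theorem star_step {G : Env} {x y z : TVar} (h : y ∈ envStar G x) (hz : z ∈ G y) :
    z ∈ envStar G x := by
  obtain ⟨n, hn⟩ := Set.mem_iUnion.1 h
  refine Set.mem_iUnion.2 ⟨n + 1, ?_⟩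
  simp only [envIter, envComp, Set.mem_iUnion]
  exact ⟨y, hn, hz⟩

theorem eval_congr {e : Expr} {σ ρ : Store} (h : ∀ y, TVar.pvar y ∈ fvT e → σ y = ρ y) :
    e.eval σ = e.eval ρ := by
  cases e with
  | const v => rfl
  | var x => exact h x (by simp [fvT, Expr.fv])

theorem while_unmod {e : Expr} {c : Cmd} {x : PVar}
    (hc : ∀ σ τ, BigStep c σ τ → τ x = σ x) {w : Cmd} {σ τ : Store} (h : BigStep w σ τ) :
    w = .while e c → τ x = σ x := by
  induction h with
  | whileTrue he h1 h2 _ ih =>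
    intro hw
    have := ih hw
    cases hw
    rw [this, hc _ _ h1]
  | whileFalse he => intro _; rfl
  | _ => intro hw; cases hw

theorem unmod {c : Cmd} {Γ : Env} (h : Typing c Γ) (x : PVar) :
    TVar.pc ∈ Γ (.pvar x) ∨
      (TVar.pvar x ∈ Γ (.pvar x) ∧ ∀ σ τ, BigStep c σ τ → τ x = σ x) := by
  induction h with
  | skip =>
    right; refine ⟨by simp [idEnv], ?_⟩
    intro σ τ h; cases h; rfl
  | assign y e =>
    by_cases hxy : x = y
    · subst hxy; left; simp
    · right; refine ⟨by simp [idEnv, hxy], ?_⟩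
      intro σ τ h; cases h; simp [hxy]
  | out e a p =>
    right; refine ⟨by simp [idEnv], ?_⟩
    intro σ τ h; cases h; rfl
  | seq h1 h2 ih1 ih2 =>
    simp only [envComp, Set.mem_iUnion]
    rcases ih2 with h | ⟨hm2, hu2⟩
    · left; exact ⟨_, h, typing_pc h1⟩
    · rcases ih1 with h | ⟨hm1, hu1⟩
      · left; exact ⟨_, hm2, h⟩
      · right
        refine ⟨⟨_, hm2, hm1⟩, ?_⟩
        intro σ τ h
        cases h with
        | seq ha hb => rw [hu2 _ _ hb, hu1 _ _ ha]
  | ite h1 h2 ih1 ih2 =>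
    rw [Function.update_of_ne (by simp)]
    rcases ih1 with h | ⟨hm1, hu1⟩
    · left; exact Or.inl (guard_of_mem h)
    · rcases ih2 with h | ⟨hm2, hu2⟩
      · left; exact Or.inr (guard_of_mem h)
      · right
        refine ⟨Or.inl (guard_of_mem hm1), ?_⟩
        intro σ τ h
        cases h with
        | iteTrue _ h => exact hu1 _ _ h
        | iteFalse _ h => exact hu2 _ _ h
  | whileT h1 ih1 =>
    rw [Function.update_of_ne (by simp)]
    rcases ih1 with h | ⟨hm1, hu1⟩
    · left; exact star_step (star_self _ _) (guard_of_mem h)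
    · right
      exact ⟨star_self _ _, fun σ τ h => while_unmod hu1 h rfl⟩

theorem while_agree {e : Expr} {c : Cmd} {S : Set TVar}
    (he : ∀ y ∈ fvT e, y ∈ S)
    (hc : ∀ σ ρ σ' ρ', BigStep c σ σ' → BigStep c ρ ρ' → (∀ y, TVar.pvar y ∈ S → σ y = ρ y) →
      ∀ y, TVar.pvar y ∈ S → σ' y = ρ' y)
    {w : Cmd} {σ σ' : Store} (h : BigStep w σ σ') :
    w = .while e c → ∀ ρ ρ', BigStep w ρ ρ' → (∀ y, TVar.pvar y ∈ S → σ y = ρ y) →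
      ∀ y, TVar.pvar y ∈ S → σ' y = ρ' y := by
  induction h with
  | whileTrue hg h1 h2 _ ih =>
    intro hw ρ ρ' hb heq
    have ih := ih hw
    cases hw
    have hev := eval_congr (e := e) fun y hy => heq y (he _ hy)
    cases hb with
    | whileTrue hg' h1' h2' => exact ih _ _ h2' (hc _ _ _ _ h1 h1' heq)
    | whileFalse hg' => exact absurd (hev.trans hg') hg
  | whileFalse hg =>
    intro hw ρ ρ' hb heq
    cases hw
    have hev := eval_congr (e := e) fun y hy => heq y (he _ hy)
    cases hb with
    | whileTrue hg' h1' h2' => exact absurd (hev.symm.trans hg) hg'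
    | whileFalse hg' => exact heq
  | _ => intro hw; cases hw

theorem big_agree {c : Cmd} {Γ : Env} (hty : Typing c Γ) :
    ∀ (σ ρ σ' ρ' : Store), BigStep c σ σ' → BigStep c ρ ρ' →
      ∀ x : PVar, eqG Γ (.pvar x) σ ρ → σ' x = ρ' x := by
  induction hty with
  | skip =>
    intro σ ρ σ' ρ' h h' x heq
    cases h; cases h'
    exact heq x (by simp [idEnv])
  | assign y e =>
    intro σ ρ σ' ρ' h h' x heq
    cases h; cases h'
    by_cases hxy : x = y
    · subst hxy
      simp only [Function.update_self]
      exact eval_congr fun z hz => heq z (by simp [hz])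
    · simp only [Function.update_of_ne hxy]
      exact heq x (by simp [idEnv, hxy])
  | out e a p =>
    intro σ ρ σ' ρ' h h' x heq
    cases h; cases h'
    exact heq x (by simp [idEnv])
  | seq h1 h2 ih1 ih2 =>
    intro σ ρ σ' ρ' h h' x heq
    cases h with
    | seq ha hb =>
      cases h' with
      | seq ha' hb' =>
        refine ih2 _ _ _ _ hb hb' x fun y hy => ih1 _ _ _ _ ha ha' y fun z hz => heq z ?_
        simp only [envComp, Set.mem_iUnion]
        exact ⟨_, hy, hz⟩
  | @ite e c₁ Γ₁ c₂ Γ₂ h1 h2 ih1 ih2 =>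
    intro σ ρ σ' ρ' h h' x heq
    unfold eqG at heq
    rw [Function.update_of_ne (by simp)] at heq
    by_cases hpc : TVar.pc ∈ Γ₁ (.pvar x) ∨ TVar.pc ∈ Γ₂ (.pvar x)
    · have hev : e.eval σ = e.eval ρ := by
        refine eval_congr fun y hy => heq y ?_
        rcases hpc with hpc | hpc
        · exact Or.inl (guard_fv hpc hy)
        · exact Or.inr (guard_fv hpc hy)
      cases h with
      | iteTrue hg hb =>
        cases h' with
        | iteTrue hg' hb' =>
          exact ih1 _ _ _ _ hb hb' x fun y hy => heq y (Or.inl (guard_of_mem hy))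
        | iteFalse hg' hb' => exact absurd (hev.trans hg') hg
      | iteFalse hg hb =>
        cases h' with
        | iteTrue hg' hb' => exact absurd (hev.symm.trans hg) hg'
        | iteFalse hg' hb' =>
          exact ih2 _ _ _ _ hb hb' x fun y hy => heq y (Or.inr (guard_of_mem hy))
    · push Not at hpc
      obtain ⟨hm1, hu1⟩ := (unmod h1 x).resolve_left hpc.1
      obtain ⟨hm2, hu2⟩ := (unmod h2 x).resolve_left hpc.2
      have key : ∀ σ τ, BigStep (.ite e c₁ c₂) σ τ → τ x = σ x := by
        intro σ τ h
        cases h with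
        | iteTrue _ h => exact hu1 _ _ h
        | iteFalse _ h => exact hu2 _ _ h
      rw [key _ _ h, key _ _ h']
      exact heq x (Or.inl (guard_of_mem hm1))
  | @whileT e c Γc h1 ih1 =>
    intro σ ρ σ' ρ' h h' x heq
    unfold eqG at heq
    rw [Function.update_of_ne (by simp)] at heq
    by_cases hpc : TVar.pc ∈ envStar (guardEnv Γc e) (.pvar x)
    · refine while_agree (S := envStar (guardEnv Γc e) (.pvar x)) ?_ ?_ h rfl ρ ρ' h' heq x
        (star_self _ _)
      · intro y hy
        exact star_step hpc (guard_fv (typing_pc h1) hy)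
      · intro σ ρ σ' ρ' hb hb' heq y hy
        exact ih1 _ _ _ _ hb hb' y fun z hz => heq z (star_step hy (guard_of_mem hz))
    · have hn : TVar.pc ∉ Γc (.pvar x) := fun hm =>
        hpc (star_step (star_self _ _) (guard_of_mem hm))
      obtain ⟨_, hu⟩ := (unmod h1 x).resolve_left hn
      rw [while_unmod hu h rfl, while_unmod hu h' rfl]
      exact heq x (star_self _ _)

/-- variables lemma. -/
theorem vars_lemma {c : Cmd} {Γ : Env} (hty : Typing c Γ) :
    ∀ (σ ρ σ' ρ' : Store) (ls ls' : List Label) (n m : ℕ),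
      Steps (c, σ) ls n (.skip, σ') → Steps (c, ρ) ls' m (.skip, ρ') →
      ∀ x : PVar, eqG Γ (.pvar x) σ ρ → σ' x = ρ' x := by
  intro σ ρ σ' ρ' ls ls' n m h h' x heq
  exact big_agree hty σ ρ σ' ρ' (big_of_steps h rfl) (big_of_steps h' rfl) x heq
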